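/- Let Σⁿ ⊂ ℝ^{n+1} be a complete immersed two-sided mean convex self-expander, fix 1 ≤ k < n, and let φ = φ(λ_k/H) with the Spruck–Xiao cutoff function φ. Then on each connected component of Σ_A, Lφ = Δφ + ⟨∇φ, x⟩ + 2⟨∇φ, ∇H/H⟩ ≤ 0. -/

import Mathlib

open scoped RealInnerProductSpace

noncomputable section

/-! Local-coordinate framework for an immersed hypersurface patch `X : ℝⁿ → ℝ^{n+1}`
with unit normal `ν`: induced metric, second fundamental form, mean curvature,
Christoffel symbols, Laplace–Beltrami operator, and the tangential drift term ⟨∇f, xᵀ⟩. -/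

abbrev Euc (n : ℕ) := EuclideanSpace ℝ (Fin n)

/-- `i`-th standard basis vector. -/
def bv (n : ℕ) (i : Fin n) : Euc n := EuclideanSpace.single i 1

/-- Partial derivative of a scalar function. -/
def pd {n : ℕ} (f : Euc n → ℝ) (i : Fin n) (p : Euc n) : ℝ := fderiv ℝ f p (bv n i)

/-- Partial derivative of a vector-valued function. -/
def pdV {n m : ℕ} (X : Euc n → Euc m) (i : Fin n) (p : Euc n) : Euc m := fderiv ℝ X p (bv n i)

/-- Induced metric g_{ij} = ⟨∂_i X, ∂_j X⟩. -/
def gm {n : ℕ} (X : Euc n → Euc (n + 1)) (i j : Fin n) (p : Euc n) : ℝ :=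
  ⟪pdV X i p, pdV X j p⟫

/-- The metric as a matrix. -/
def gMat {n : ℕ} (X : Euc n → Euc (n + 1)) (p : Euc n) : Matrix (Fin n) (Fin n) ℝ :=
  Matrix.of fun i j => gm X i j p

/-- The inverse metric g^{ij}. -/
def gInv {n : ℕ} (X : Euc n → Euc (n + 1)) (p : Euc n) : Matrix (Fin n) (Fin n) ℝ :=
  (gMat X p)⁻¹

/-- Second fundamental form h_{ij} = ⟨∂_i∂_j X, ν⟩. -/
def sff {n : ℕ} (X ν : Euc n → Euc (n + 1)) (i j : Fin n) (p : Euc n) : ℝ :=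
  ⟪pdV (pdV X i) j p, ν p⟫

/-- Mean curvature H = g^{ij} h_{ij}. -/
def meanCurv {n : ℕ} (X ν : Euc n → Euc (n + 1)) (p : Euc n) : ℝ :=
  ∑ i, ∑ j, gInv X p i j * sff X ν i j p

/-- Squared norm of the second fundamental form |A|² = g^{ia} g^{jb} h_{ij} h_{ab}. -/
def normA2 {n : ℕ} (X ν : Euc n → Euc (n + 1)) (p : Euc n) : ℝ :=
  ∑ i, ∑ j, ∑ a, ∑ b, gInv X p i a * gInv X p j b * sff X ν i j p * sff X ν a b p

/-- Christoffel symbols Γ^k_{ij} = ½ g^{kl} (∂_i g_{jl} + ∂_j g_{il} − ∂_l g_{ij}). -/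
def christ {n : ℕ} (X : Euc n → Euc (n + 1)) (k i j : Fin n) (p : Euc n) : ℝ :=
  (1 / 2) * ∑ l, gInv X p k l * (pd (gm X j l) i p + pd (gm X i l) j p - pd (gm X i j) l p)

/-- Laplace–Beltrami operator Δf = g^{ij} (∂_i∂_j f − Γ^a_{ij} ∂_a f). -/
def lapBel {n : ℕ} (X : Euc n → Euc (n + 1)) (f : Euc n → ℝ) (p : Euc n) : ℝ :=
  ∑ i, ∑ j, gInv X p i j * (pd (pd f j) i p - ∑ a, christ X a i j p * pd f a p)

/-- Drift term ⟨∇f, xᵀ⟩ = g^{ij} ∂_j f ⟨∂_i X, X⟩. -/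
def driftTerm {n : ℕ} (X ν : Euc n → Euc (n + 1)) (f : Euc n → ℝ) (p : Euc n) : ℝ :=
  ∑ i, ∑ j, gInv X p i j * pd f j p * ⟪pdV X i p, X p⟫

/-- Covariant derivative of the second fundamental form:
(∇h)_{kij} = ∂_k h_{ij} − Γ^a_{ki} h_{aj} − Γ^a_{kj} h_{ia}. -/
def covDh {n : ℕ} (X ν : Euc n → Euc (n + 1)) (k i j : Fin n) (p : Euc n) : ℝ :=
  pd (sff X ν i j) k p - (∑ a, christ X a k i p * sff X ν a j p)
    - ∑ a, christ X a k j p * sff X ν i a p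

/-- The Spruck–Xiao cutoff function. -/
def phiSX : ℝ → ℝ := fun t => if t < 0 then -t ^ 4 * Real.exp (-1 / t ^ 2) else 0

/-- λ_k = κ₁ + ⋯ + κ_k (0-indexed: the sum of the k smallest principal curvatures). -/
def lamk {n : ℕ} (κ : Euc n → Fin n → ℝ) (k : ℕ) (p : Euc n) : ℝ :=
  ∑ i ∈ Finset.univ.filter (fun i : Fin n => i.val < k), κ p i

/-- The quotient λ_k/H. -/
def ratk {n : ℕ} (X ν : Euc n → Euc (n + 1)) (κ : Euc n → Fin n → ℝ) (k : ℕ) (p : Euc n) : ℝ :=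
  lamk κ k p / meanCurv X ν p

/-- Intrinsic inner product of gradients: ⟨∇f, ∇g⟩ = g^{ij} ∂_i f ∂_j g. -/
def gradSq {n : ℕ} (X : Euc n → Euc (n + 1)) (f g : Euc n → ℝ) (p : Euc n) : ℝ :=
  ∑ i, ∑ j, gInv X p i j * pd f i p * pd g j p

/-- The operator L f = Δf + ⟨∇f, x⟩ + 2⟨∇f, ∇H/H⟩. -/
def Lop {n : ℕ} (X ν : Euc n → Euc (n + 1)) (f : Euc n → ℝ) (p : Euc n) : ℝ :=
  lapBel X f p + driftTerm X ν f p + 2 * gradSq X f (meanCurv X ν) p / meanCurv X ν p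

/-- Number of distinct principal curvatures. -/
def numDistinct {n : ℕ} (κ : Euc n → Fin n → ℝ) (p : Euc n) : ℕ :=
  (Finset.univ.image (κ p)).card

/-- Components of ∇h in the adapted orthonormal eigenframe τ:
∇_{τ_a} h(τ_l, τ_s) = Σ_{b,c,e} (∇h)_{bce} τ_a^b τ_l^c τ_s^e. -/
def frameDh {n : ℕ} (X ν : Euc n → Euc (n + 1)) (τ : Euc n → Fin n → Fin n → ℝ)
    (a l s : Fin n) (p : Euc n) : ℝ :=
  ∑ b, ∑ c, ∑ e, covDh X ν b c e p * τ p a b * τ p l c * τ p s e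

/-- Derivative of `f` along the vector field `t`. -/
def dirD {n : ℕ} {F : Type*} [NormedAddCommGroup F] [NormedSpace ℝ F]
    (t : Euc n → Euc n) (f : Euc n → F) (p : Euc n) : F := fderiv ℝ f p (t p)

section DirectionalDerivative

variable {n : ℕ} {F : Type*} [NormedAddCommGroup F] [NormedSpace ℝ F]
  {Ω : Set (Euc n)} {p : Euc n} {s t : Euc n → Euc n}

theorem ContDiffOn.dirD {f : Euc n → F} (hΩ : IsOpen Ω) (ht : ContDiffOn ℝ (⊤ : ℕ∞) t Ω)
    (hf : ContDiffOn ℝ (⊤ : ℕ∞) f Ω) : ContDiffOn ℝ (⊤ : ℕ∞) (dirD t f) Ω :=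
  (hf.fderiv_of_isOpen hΩ (by simp)).clm_apply ht

theorem ContDiffOn.differentiableAt_of_isOpen {f : Euc n → F} (hΩ : IsOpen Ω)
    (hf : ContDiffOn ℝ (⊤ : ℕ∞) f Ω) (hp : p ∈ Ω) : DifferentiableAt ℝ f p :=
  (hf.contDiffAt (hΩ.mem_nhds hp)).differentiableAt (by simp)

theorem ContDiffOn.contDiffAt_two_of_isOpen {f : Euc n → F} (hΩ : IsOpen Ω)
    (hf : ContDiffOn ℝ (⊤ : ℕ∞) f Ω) (hp : p ∈ Ω) : ContDiffAt ℝ 2 f p :=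
  (hf.contDiffAt (hΩ.mem_nhds hp)).of_le (WithTop.coe_le_coe.2 le_top)

theorem dirD_congr {f g : Euc n → F} (hΩ : IsOpen Ω) (h : Set.EqOn f g Ω) (hp : p ∈ Ω) :
    dirD t f p = dirD t g p := by
  unfold dirD
  rw [(h.eventuallyEq_of_mem (hΩ.mem_nhds hp)).fderiv_eq]

theorem dirD_const (c : F) : dirD t (fun _ => c) p = 0 := by
  simp [dirD]

theorem dirD_sum {ι : Type*} (u : Finset ι) {f : ι → Euc n → F}
    (hf : ∀ i ∈ u, DifferentiableAt ℝ (f i) p) :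
    dirD t (fun q => ∑ i ∈ u, f i q) p = ∑ i ∈ u, dirD t (f i) p := by
  simp only [dirD]
  rw [fderiv_fun_sum hf]
  simp

theorem dirD_neg {f : Euc n → F} : dirD t (fun q => -f q) p = -dirD t f p := by
  simp [dirD]

theorem dirD_add {f g : Euc n → F} (hf : DifferentiableAt ℝ f p) (hg : DifferentiableAt ℝ g p) :
    dirD t (fun q => f q + g q) p = dirD t f p + dirD t g p := by
  simp [dirD, fderiv_fun_add hf hg]

theorem dirD_sub {f g : Euc n → F} (hf : DifferentiableAt ℝ f p) (hg : DifferentiableAt ℝ g p) :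
    dirD t (fun q => f q - g q) p = dirD t f p - dirD t g p := by
  simp [dirD, fderiv_fun_sub hf hg]

theorem dirD_smul {c : Euc n → ℝ} {f : Euc n → F} (hc : DifferentiableAt ℝ c p)
    (hf : DifferentiableAt ℝ f p) :
    dirD t (fun q => c q • f q) p = dirD t c p • f p + c p • dirD t f p := by
  simp [dirD, fderiv_fun_smul hc hf, add_comm]

theorem dirD_mul {f g : Euc n → ℝ} (hf : DifferentiableAt ℝ f p) (hg : DifferentiableAt ℝ g p) :
    dirD t (fun q => f q * g q) p = dirD t f p * g p + f p * dirD t g p :=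
  dirD_smul hf hg

theorem dirD_inner {m : ℕ} {f g : Euc n → Euc m} (hf : DifferentiableAt ℝ f p)
    (hg : DifferentiableAt ℝ g p) :
    dirD t (fun q => ⟪f q, g q⟫) p = ⟪dirD t f p, g p⟫ + ⟪f p, dirD t g p⟫ := by
  simp [dirD, fderiv_inner_apply ℝ hf hg, add_comm]

theorem dirD_dirD {f : Euc n → F} (hf : ContDiffAt ℝ 2 f p) (ht : DifferentiableAt ℝ t p) :
    dirD s (dirD t f) p
      = fderiv ℝ (fderiv ℝ f) p (s p) (t p) + fderiv ℝ f p (dirD s t p) := by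
  have h1 : DifferentiableAt ℝ (fderiv ℝ f) p :=
    (hf.fderiv_right (m := 1) (by norm_num)).differentiableAt (by simp)
  change fderiv ℝ (fun q => fderiv ℝ f q (t q)) p (s p) = _
  rw [fderiv_clm_apply h1 ht]
  simp [dirD, add_comm]

theorem dirD_comm {f : Euc n → F} (hf : ContDiffAt ℝ 2 f p) (hs : DifferentiableAt ℝ s p)
    (ht : DifferentiableAt ℝ t p) :
    dirD s (dirD t f) p - dirD t (dirD s f) p
      = fderiv ℝ f p (dirD s t p - dirD t s p) := by
  rw [dirD_dirD hf ht, dirD_dirD hf hs, map_sub,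
    (hf.isSymmSndFDerivAt (by simp)).eq (s p) (t p)]
  abel

end DirectionalDerivative

/-- The symmetrised frame identity behind the evolution of a principal curvature: `d j i` stands
for `∇_{e_j} κ_i` and `ω j i m` for `⟨∇_{e_j} e_i, e_m⟩`, related by the Codazzi equation. -/
theorem frame_quadratic_identity {n : ℕ} (κ : Fin n → ℝ) (d : Fin n → Fin n → ℝ)
    (ω : Fin n → Fin n → Fin n → ℝ) (hω : ∀ i j m, ω i j m = -ω i m j)
    (hcod : ∀ j i m, (if i = m then d j i else 0) + (κ i - κ m) * ω j i m
      = (if j = m then d i j else 0) + (κ j - κ m) * ω i j m) (s : Fin n) :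
    ∑ i, ((d i i - d i s) * ω s i s - (d s i - d s s) * ω i i s
        + (κ i - κ s) * ∑ m, (ω s i m * ω i s m - ω i i m * ω s s m
          + (ω i s m - ω s i m) * ω m i s))
      - ∑ i, ∑ m, ω i i m * d m s + ∑ m, ω s s m * ∑ i, d m i
      = 2 * ∑ i, ∑ m, (κ s - κ m) * ω i s m ^ 2 := by
  set h : Fin n → Fin n → Fin n → ℝ :=
    fun j i m => (if i = m then d j i else 0) + (κ i - κ m) * ω j i m with hh
  have h12 : ∀ j i m, h j i m = h i j m := hcod
  have h23 : ∀ j i m, h j i m = h j m i := by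
    intro j i m
    simp only [hh]
    rw [hω j i m]
    by_cases e : i = m
    · subst e; simp
    · simp only [e, Ne.symm e, if_false]; ring
  have hdiag : ∀ j i, h j i i = d j i := by intro j i; simp [hh]
  have hω0 : ∀ i j, ω i j j = 0 := by intro i j; linarith [hω i j j]
  have e1 : ∀ j i m, (κ i - κ m) * ω j i m = h j i m - if i = m then d j i else 0 := by
    intro j i m; simp [hh]
  have key : ∀ i m, (κ i - κ s) * (ω s i m * ω i s m - ω i i m * ω s s m
      + (ω i s m - ω s i m) * ω m i s)
      = 2 * (ω i s m * h i m s) - ω s i m * (h i s m + h m i s)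
        - ω i s m * (if i = m then d s i else 0) + ω s i m * (if s = m then d i s else 0)
        - ω s s m * d m i + ω s s m * (if i = m then d i i else 0)
        + ω i i m * d m s - ω i i m * (if s = m then d s s else 0)
        - (ω i s m - ω s i m) * (if i = s then d m i else 0) := by
    intro i m
    have a1 := e1 s i m
    have a2 := e1 i s m
    have a3 := e1 m i s
    have a4 := e1 i i m
    have a5 := e1 s s m
    have b1 : h s i m = h i m s := by rw [h12, h23]
    have b2 : h m i s = h i m s := by rw [h12]
    have b4 : h i i m = d m i := by rw [h23, h12, hdiag]
    have b5 : h s s m = d m s := by rw [h23, h12, hdiag]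
    rw [b1] at a1
    rw [b4] at a4
    rw [b5] at a5
    rw [b2] at a3 ⊢
    linear_combination ω i s m * a1 - ω s i m * a2 + (ω i s m - ω s i m) * a3
      - ω s s m * a4 + ω i i m * a5
  have hh_ω : ∀ i m, ω i s m * h i m s = (κ s - κ m) * ω i s m ^ 2 := by
    intro i m
    simp only [hh]
    rw [hω i m s]
    by_cases e : m = s
    · subst e; simp [hω0]
    · simp only [e, if_false]; ring
  have hanti : ∑ i, ∑ m, ω s i m * (h i s m + h m i s) = 0 := by
    have hswap : ∑ i, ∑ m, ω s i m * (h i s m + h m i s)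
        = -∑ i, ∑ m, ω s i m * (h i s m + h m i s) := by
      conv_lhs => rw [Finset.sum_comm]
      simp only [← Finset.sum_neg_distrib]
      refine Finset.sum_congr rfl fun i _ => Finset.sum_congr rfl fun m _ => ?_
      rw [hω s m i, h23 m s i, h23 i s m]
      ring
    linarith
  have hsum : ∀ i, (κ i - κ s) * ∑ m, (ω s i m * ω i s m - ω i i m * ω s s m
      + (ω i s m - ω s i m) * ω m i s)
      = 2 * ∑ m, (κ s - κ m) * ω i s m ^ 2 - ∑ m, ω s i m * (h i s m + h m i s)
        - ω i s i * d s i + ω s i s * d i s - ∑ m, ω s s m * d m i + ω s s i * d i i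
        + ∑ m, ω i i m * d m s - ω i i s * d s s := by
    intro i
    have hz : ∑ m, (ω i s m - ω s i m) * (if i = s then d m i else 0) = 0 := by
      by_cases e : i = s
      · subst e; simp
      · simp [e]
    rw [Finset.mul_sum, Finset.sum_congr rfl fun m _ => key i m, Finset.sum_sub_distrib, hz,
      sub_zero]
    simp only [Finset.sum_sub_distrib, Finset.sum_add_distrib, hh_ω, mul_ite, mul_zero,
      Finset.sum_ite_eq, Finset.mem_univ, if_true, Finset.mul_sum]
  have hH : ∑ m, ω s s m * ∑ i, d m i = ∑ i, ∑ m, ω s s m * d m i := by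
    rw [Finset.sum_comm]
    simp only [Finset.mul_sum]
  rw [hH, ← Finset.sum_sub_distrib, ← Finset.sum_add_distrib]
  have hterm : ∀ i, (d i i - d i s) * ω s i s - (d s i - d s s) * ω i i s
        + (κ i - κ s) * ∑ m, (ω s i m * ω i s m - ω i i m * ω s s m
          + (ω i s m - ω s i m) * ω m i s)
      - ∑ m, ω i i m * d m s + ∑ m, ω s s m * d m i
      = 2 * ∑ m, (κ s - κ m) * ω i s m ^ 2 - ∑ m, ω s i m * (h i s m + h m i s) := by
    intro i
    rw [hsum i, hω s s i, hω i s i]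
    ring
  rw [Finset.sum_congr rfl fun i _ => hterm i, Finset.sum_sub_distrib, hanti, sub_zero,
    Finset.mul_sum]

/-- A smooth orthonormal frame `t` of principal directions along a hypersurface patch `X` with
unit normal `ν` and principal curvatures `κ`, over the open set `Ω`. -/
structure IsPrincipalFrame {n : ℕ} (X ν : Euc n → Euc (n + 1)) (Ω : Set (Euc n))
    (κ : Euc n → Fin n → ℝ) (t : Fin n → Euc n → Euc n) : Prop where
  isOpen : IsOpen Ω
  smooth_immersion : ContDiffOn ℝ (⊤ : ℕ∞) X Ω
  smooth_normal : ContDiffOn ℝ (⊤ : ℕ∞) ν Ω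
  smooth_frame : ∀ i, ContDiffOn ℝ (⊤ : ℕ∞) (t i) Ω
  smooth_curvature : ∀ i, ContDiffOn ℝ (⊤ : ℕ∞) (fun p => κ p i) Ω
  orthonormal : ∀ p ∈ Ω, ∀ i j,
    ⟪dirD (t i) X p, dirD (t j) X p⟫ = if i = j then (1 : ℝ) else 0
  unit : ∀ p ∈ Ω, ⟪ν p, ν p⟫ = (1 : ℝ)
  normal : ∀ p ∈ Ω, ∀ v, ⟪fderiv ℝ X p v, ν p⟫ = (0 : ℝ)
  sff : ∀ p ∈ Ω, ∀ i j, ⟪dirD (t i) (dirD (t j) X) p, ν p⟫ = if i = j then κ p i else 0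
  expand : ∀ p ∈ Ω, ∀ v, v = ∑ m, ⟪fderiv ℝ X p v, dirD (t m) X p⟫ • t m p

/-- Connection coefficients `⟨∇_{t i} (t j), t k⟩` of a frame. -/
def conn {n : ℕ} (X : Euc n → Euc (n + 1)) (t : Fin n → Euc n → Euc n) (i j k : Fin n)
    (p : Euc n) : ℝ :=
  ⟪dirD (t i) (dirD (t j) X) p, dirD (t k) X p⟫

namespace IsPrincipalFrame

variable {n : ℕ} {X ν : Euc n → Euc (n + 1)} {Ω : Set (Euc n)} {κ : Euc n → Fin n → ℝ}
  {t : Fin n → Euc n → Euc n} {p : Euc n}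

theorem smooth_dirD (h : IsPrincipalFrame X ν Ω κ t) {F : Type*} [NormedAddCommGroup F]
    [NormedSpace ℝ F] {f : Euc n → F} (hf : ContDiffOn ℝ (⊤ : ℕ∞) f Ω) (i : Fin n) :
    ContDiffOn ℝ (⊤ : ℕ∞) (dirD (t i) f) Ω :=
  ContDiffOn.dirD h.isOpen (h.smooth_frame i) hf

theorem smooth_conn (h : IsPrincipalFrame X ν Ω κ t) (i j k : Fin n) :
    ContDiffOn ℝ (⊤ : ℕ∞) (conn X t i j k) Ω :=
  (h.smooth_dirD (h.smooth_dirD h.smooth_immersion j) i).inner ℝ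
    (h.smooth_dirD h.smooth_immersion k)

theorem dirD_normal (h : IsPrincipalFrame X ν Ω κ t) (hp : p ∈ Ω) (i : Fin n) :
    ⟪dirD (t i) X p, ν p⟫ = (0 : ℝ) :=
  h.normal p hp _

theorem inner_eq_sum (h : IsPrincipalFrame X ν Ω κ t) (hp : p ∈ Ω) (v w : Euc (n + 1)) :
    ⟪v, w⟫ = ∑ m, ⟪v, dirD (t m) X p⟫ * ⟪w, dirD (t m) X p⟫ + ⟪v, ν p⟫ * ⟪w, ν p⟫ := by
  let b : Option (Fin n) → Euc (n + 1) := fun o => o.elim (ν p) fun i => dirD (t i) X p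
  have hb : Orthonormal ℝ b := by
    rw [orthonormal_iff_ite]
    rintro (_ | i) (_ | j)
    · simpa [b] using h.unit p hp
    · simpa [b, real_inner_comm] using h.dirD_normal hp j
    · simpa [b] using h.dirD_normal hp i
    · simpa [b] using h.orthonormal p hp i j
  have hspan : ⊤ ≤ Submodule.span ℝ (Set.range b) :=
    (hb.linearIndependent.span_eq_top_of_card_eq_finrank (by simp)).ge
  have hsum := (OrthonormalBasis.mk hb hspan).sum_inner_mul_inner v w
  rw [← hsum]
  simp [Fintype.sum_option, b, real_inner_comm w, add_comm]

theorem ext_inner (h : IsPrincipalFrame X ν Ω κ t) (hp : p ∈ Ω) {v w : Euc (n + 1)}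
    (hT : ∀ m, ⟪v, dirD (t m) X p⟫ = (⟪w, dirD (t m) X p⟫ : ℝ))
    (hN : ⟪v, ν p⟫ = (⟪w, ν p⟫ : ℝ)) : v = w := by
  refine ext_inner_right ℝ fun u => ?_
  rw [h.inner_eq_sum hp v u, h.inner_eq_sum hp w u, hN]
  simp only [hT]

theorem conn_antisymm (h : IsPrincipalFrame X ν Ω κ t) (hp : p ∈ Ω) (i j k : Fin n) :
    conn X t i j k p = -conn X t i k j p := by
  have hE := fun j => (h.smooth_dirD h.smooth_immersion j).differentiableAt_of_isOpen h.isOpen hp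
  have h1 := dirD_congr (t := t i) h.isOpen (fun q hq => h.orthonormal q hq j k) hp
  rw [dirD_inner (hE j) (hE k), dirD_const,
    real_inner_comm (dirD (t i) (dirD (t k) X) p) (dirD (t j) X p)] at h1
  exact eq_neg_of_add_eq_zero_left h1

theorem commutator (h : IsPrincipalFrame X ν Ω κ t) (hp : p ∈ Ω) {F : Type*}
    [NormedAddCommGroup F] [NormedSpace ℝ F] {f : Euc n → F}
    (hf : ContDiffOn ℝ (⊤ : ℕ∞) f Ω) (i j : Fin n) :
    dirD (t j) (dirD (t i) f) p - dirD (t i) (dirD (t j) f) p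
      = ∑ m, (conn X t j i m p - conn X t i j m p) • dirD (t m) f p := by
  have ht := fun i => (h.smooth_frame i).differentiableAt_of_isOpen h.isOpen hp
  have hX := h.smooth_immersion.contDiffAt_two_of_isOpen h.isOpen hp
  rw [dirD_comm (hf.contDiffAt_two_of_isOpen h.isOpen hp) (ht j) (ht i),
    h.expand p hp (dirD (t j) (t i) p - dirD (t i) (t j) p), map_sum]
  refine Finset.sum_congr rfl fun m _ => ?_
  rw [map_smul, ← dirD_comm hX (ht j) (ht i), inner_sub_left]
  rfl

theorem weingarten (h : IsPrincipalFrame X ν Ω κ t) (hp : p ∈ Ω) (i : Fin n) :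
    dirD (t i) ν p = -(κ p i • dirD (t i) X p) := by
  have hE := fun j => (h.smooth_dirD h.smooth_immersion j).differentiableAt_of_isOpen h.isOpen hp
  have hν := h.smooth_normal.differentiableAt_of_isOpen h.isOpen hp
  refine h.ext_inner hp (fun m => ?_) ?_
  · have h1 := dirD_congr (t := t i) h.isOpen (fun q hq => h.dirD_normal hq m) hp
    rw [dirD_inner (hE m) hν, dirD_const, h.sff p hp, real_inner_comm] at h1
    rw [inner_neg_left, inner_smul_left, h.orthonormal p hp]
    simp only [mul_ite, mul_one, mul_zero]
    simpa using eq_neg_of_add_eq_zero_right h1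
  · have h1 := dirD_congr (t := t i) h.isOpen h.unit hp
    rw [dirD_inner hν hν, dirD_const, real_inner_comm (dirD (t i) ν p)] at h1
    rw [inner_neg_left, inner_smul_left, h.dirD_normal hp]
    simp only [mul_zero, neg_zero]
    linarith

theorem codazzi (h : IsPrincipalFrame X ν Ω κ t) (hp : p ∈ Ω) (j i m : Fin n) :
    (if i = m then dirD (t j) (fun q => κ q i) p else 0) + (κ p i - κ p m) * conn X t j i m p
      = (if j = m then dirD (t i) (fun q => κ q j) p else 0)
        + (κ p j - κ p m) * conn X t i j m p := by
  have hE := fun j => (h.smooth_dirD h.smooth_immersion j).differentiableAt_of_isOpen h.isOpen hp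
  have hκ := fun j => (h.smooth_curvature j).differentiableAt_of_isOpen h.isOpen hp
  have h2 : ∀ i j, dirD (t j) (dirD (t i) ν) p = -(dirD (t j) (fun q => κ q i) p • dirD (t i) X p
      + κ p i • dirD (t j) (dirD (t i) X) p) := by
    intro i j
    rw [dirD_congr h.isOpen (fun q hq => h.weingarten hq i) hp, dirD_neg, dirD_smul (hκ i) (hE i)]
  have h3 := congrArg (fun v => ⟪v, dirD (t m) X p⟫) (h.commutator hp h.smooth_normal i j)
  simp only [h2, inner_sub_left, inner_neg_left, inner_add_left, inner_smul_left, sum_inner,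
    h.weingarten hp, h.orthonormal p hp, conj_trivial] at h3
  simp only [mul_ite, mul_one, mul_zero, mul_neg,
    Finset.sum_neg_distrib, Finset.sum_ite_eq', Finset.mem_univ, if_true] at h3
  simp only [conn] at h3 ⊢
  linarith

theorem gauss (h : IsPrincipalFrame X ν Ω κ t) (hp : p ∈ Ω) (i s : Fin n) :
    dirD (t i) (conn X t s i s) p - dirD (t s) (conn X t i i s) p
      = ∑ m, (conn X t s i m p * conn X t i s m p - conn X t i i m p * conn X t s s m p
          + (conn X t i s m p - conn X t s i m p) * conn X t m i s p)
        - κ p i * κ p s + if i = s then κ p i * κ p s else 0 := by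
  have hE := fun j => h.smooth_dirD h.smooth_immersion j
  have hE1 := fun j => (hE j).differentiableAt_of_isOpen h.isOpen hp
  have hE2 := fun i j => (h.smooth_dirD (hE j) i).differentiableAt_of_isOpen h.isOpen hp
  have h1 : ∀ a b c d, dirD (t d) (conn X t a b c) p
      = ⟪dirD (t d) (dirD (t a) (dirD (t b) X)) p, dirD (t c) X p⟫
        + ⟪dirD (t a) (dirD (t b) X) p, dirD (t d) (dirD (t c) X) p⟫ :=
    fun a b c d => dirD_inner (hE2 a b) (hE1 c)
  have h3 := congrArg (fun v => ⟪v, dirD (t s) X p⟫) (h.commutator hp (hE i) s i)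
  simp only [inner_sub_left, sum_inner, inner_smul_left, conj_trivial] at h3
  rw [h1, h1, h.inner_eq_sum hp (dirD (t s) (dirD (t i) X) p),
    h.inner_eq_sum hp (dirD (t i) (dirD (t i) X) p), h.sff p hp, h.sff p hp, h.sff p hp,
    h.sff p hp, Finset.sum_add_distrib, Finset.sum_sub_distrib]
  simp only [conn] at h3 ⊢
  rw [← h3]
  by_cases e : i = s
  · subst e; simp
  · simp [e, Ne.symm e]; ring

end IsPrincipalFrame

/-- The drift Laplacian `Δf + ⟨∇f, x⟩` expressed in a frame. -/
def frameDriftLap {n : ℕ} (X : Euc n → Euc (n + 1)) (t : Fin n → Euc n → Euc n)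
    (f : Euc n → ℝ) (p : Euc n) : ℝ :=
  ∑ i, (dirD (t i) (dirD (t i) f) p - ∑ m, conn X t i i m p * dirD (t m) f p
    + ⟪X p, dirD (t i) X p⟫ * dirD (t i) f p)

namespace IsPrincipalFrame

variable {n : ℕ} {X ν : Euc n → Euc (n + 1)} {Ω : Set (Euc n)} {κ : Euc n → Fin n → ℝ}
  {t : Fin n → Euc n → Euc n} {p : Euc n} {H : Euc n → ℝ}

theorem dirD_expander (h : IsPrincipalFrame X ν Ω κ t) (hp : p ∈ Ω)
    (hH : ∀ q ∈ Ω, H q = ⟪X q, ν q⟫) (i : Fin n) :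
    dirD (t i) H p = -(κ p i * ⟪X p, dirD (t i) X p⟫) := by
  rw [dirD_congr h.isOpen hH hp,
    dirD_inner (h.smooth_immersion.differentiableAt_of_isOpen h.isOpen hp)
      (h.smooth_normal.differentiableAt_of_isOpen h.isOpen hp),
    h.dirD_normal hp, h.weingarten hp, inner_neg_right, inner_smul_right, zero_add]

theorem dirD_dirD_expander (h : IsPrincipalFrame X ν Ω κ t) (hp : p ∈ Ω)
    (hH : ∀ q ∈ Ω, H q = ⟪X q, ν q⟫) (s : Fin n) :
    dirD (t s) (dirD (t s) H) p
      = -(dirD (t s) (fun q => κ q s) p * ⟪X p, dirD (t s) X p⟫)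
        - κ p s * (1 + ∑ m, conn X t s s m p * ⟪X p, dirD (t m) X p⟫ + κ p s * H p) := by
  have hX := h.smooth_immersion.differentiableAt_of_isOpen h.isOpen hp
  have hE := (h.smooth_dirD h.smooth_immersion s).differentiableAt_of_isOpen h.isOpen hp
  have hκ := (h.smooth_curvature s).differentiableAt_of_isOpen h.isOpen hp
  rw [dirD_congr h.isOpen (fun q hq => h.dirD_expander hq hH s) hp, dirD_neg,
    dirD_mul hκ (hX.inner ℝ hE), dirD_inner hX hE, h.orthonormal p hp,
    real_inner_comm (dirD (t s) (dirD (t s) X) p),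
    h.inner_eq_sum hp (dirD (t s) (dirD (t s) X) p), h.sff p hp, hH p hp]
  simp only [conn, if_true]
  ring

/-- Evolution of a principal curvature of a self-expander under the drift Laplacian. -/
theorem frameDriftLap_curvature (h : IsPrincipalFrame X ν Ω κ t) (hp : p ∈ Ω)
    (hH : ∀ q ∈ Ω, H q = ⟪X q, ν q⟫) (hHκ : ∀ q ∈ Ω, H q = ∑ i, κ q i) (s : Fin n) :
    frameDriftLap X t (fun q => κ q s) p
      = -(∑ i, κ p i ^ 2 + 1) * κ p s
        + 2 * ∑ i, ∑ m, (κ p s - κ p m) * conn X t i s m p ^ 2 := by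
  have hκ := fun j => (h.smooth_curvature j).differentiableAt_of_isOpen h.isOpen hp
  have hdκ := fun i j =>
    (h.smooth_dirD (h.smooth_curvature j) i).differentiableAt_of_isOpen h.isOpen hp
  have hω := fun i j k => (h.smooth_conn i j k).differentiableAt_of_isOpen h.isOpen hp
  have hswap : ∀ i, dirD (t i) (dirD (t i) fun q => κ q s) p
      = dirD (t s) (dirD (t s) fun q => κ q i) p
        + ((dirD (t i) (fun q => κ q i) p - dirD (t i) (fun q => κ q s) p) * conn X t s i s p
          - (dirD (t s) (fun q => κ q i) p - dirD (t s) (fun q => κ q s) p) * conn X t i i s p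
          + (κ p i - κ p s) * (dirD (t i) (conn X t s i s) p - dirD (t s) (conn X t i i s) p)) := by
    intro i
    by_cases e : i = s
    · subst e; simp
    · have h1 : Set.EqOn (dirD (t i) fun q => κ q s)
          (fun q => (κ q i - κ q s) * conn X t s i s q) Ω := by
        intro q hq
        have := h.codazzi hq i s s
        simpa [e] using this
      have h2 : Set.EqOn (dirD (t s) fun q => κ q i)
          (fun q => (κ q i - κ q s) * conn X t i i s q) Ω := by
        intro q hq
        have := h.codazzi hq s i i
        simp only [if_true, sub_self, zero_mul, add_zero, Ne.symm e, if_false, zero_add] at this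
        rw [this, h.conn_antisymm hq i s i]
        ring
      have hsub : DifferentiableAt ℝ (fun q => κ q i - κ q s) p := (hκ i).sub (hκ s)
      rw [dirD_congr h.isOpen h1 hp, dirD_congr h.isOpen h2 hp,
        dirD_mul hsub (hω s i s), dirD_mul hsub (hω i i s),
        dirD_sub (hκ i) (hκ s), dirD_sub (hκ i) (hκ s)]
      ring
  have hdH : ∀ q ∈ Ω, ∀ j, dirD (t j) H q = ∑ i, dirD (t j) (fun q => κ q i) q := by
    intro q hq j
    rw [dirD_congr h.isOpen hHκ hq,
      dirD_sum _ fun i _ => (h.smooth_curvature i).differentiableAt_of_isOpen h.isOpen hq]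
  have hddH : dirD (t s) (dirD (t s) H) p = ∑ i, dirD (t s) (dirD (t s) fun q => κ q i) p := by
    rw [dirD_congr h.isOpen (fun q hq => hdH q hq s) hp, dirD_sum _ fun i _ => hdκ s i]
  have hquad := frame_quadratic_identity (κ p) (fun j i => dirD (t j) (fun q => κ q i) p)
    (fun i j k => conn X t i j k p) (fun i j k => h.conn_antisymm hp i j k)
    (fun j i m => h.codazzi hp j i m) s
  have hgrad : ∀ m, ⟪X p, dirD (t m) X p⟫ * dirD (t m) (fun q => κ q s) p
      = (if s = m then dirD (t s) (fun q => κ q s) p * ⟪X p, dirD (t s) X p⟫ else 0)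
        + (κ p s - κ p m) * conn X t s s m p * ⟪X p, dirD (t m) X p⟫ := by
    intro m
    have h1 := h.codazzi hp m s s
    have h2 := h.codazzi hp s m s
    have h3 := h.codazzi hp s s m
    have h4 := h.conn_antisymm hp s m s
    by_cases e : s = m
    · subst e; simp; ring
    · simp only [e, Ne.symm e, if_true, if_false, sub_self, zero_mul, add_zero, zero_add]
        at h1 h2 h3 ⊢
      rw [h1, h4]
      ring
  have hdHs : ∀ m, conn X t s s m p * ∑ i, dirD (t m) (fun q => κ q i) p
      = -(κ p m * conn X t s s m p * ⟪X p, dirD (t m) X p⟫) := by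
    intro m
    rw [← hdH p hp, h.dirD_expander hp hH]
    ring
  have hgauss : ∀ i, (κ p i - κ p s)
        * (dirD (t i) (conn X t s i s) p - dirD (t s) (conn X t i i s) p)
      = (κ p i - κ p s) * ∑ m, (conn X t s i m p * conn X t i s m p
          - conn X t i i m p * conn X t s s m p
          + (conn X t i s m p - conn X t s i m p) * conn X t m i s p)
        - (κ p s * κ p i ^ 2 - κ p s ^ 2 * κ p i) := by
    intro i
    rw [h.gauss hp i s]
    by_cases e : i = s
    · subst e; simp; ring
    · simp only [e, if_false]; ring
  have hss := h.dirD_dirD_expander hp hH s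
  rw [hddH, hHκ p hp] at hss
  unfold frameDriftLap
  simp only [hswap, hgauss, hgrad, Finset.sum_add_distrib, Finset.sum_sub_distrib,
    ← Finset.mul_sum, hss, Finset.sum_ite_eq, Finset.mem_univ, if_true]
  simp only [hdHs, Finset.sum_add_distrib, Finset.sum_sub_distrib, Finset.sum_neg_distrib]
    at hquad
  have hsplit : ∑ m, (κ p s - κ p m) * conn X t s s m p * ⟪X p, dirD (t m) X p⟫
      = κ p s * ∑ m, conn X t s s m p * ⟪X p, dirD (t m) X p⟫
        - ∑ m, κ p m * conn X t s s m p * ⟪X p, dirD (t m) X p⟫ := by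
    rw [Finset.mul_sum, ← Finset.sum_sub_distrib]
    exact Finset.sum_congr rfl fun m _ => by ring
  rw [hsplit]
  linear_combination hquad

end IsPrincipalFrame

theorem clm_apply_eq_sum {n : ℕ} {F : Type*} [NormedAddCommGroup F] [NormedSpace ℝ F]
    (L : Euc n →L[ℝ] F) (v : Euc n) : L v = ∑ a, v a • L (bv n a) := by
  conv_lhs => rw [← (EuclideanSpace.basisFun (Fin n) ℝ).sum_repr v]
  simp [map_sum, bv]

theorem clm_apply₂_eq_sum {n : ℕ} {F : Type*} [NormedAddCommGroup F] [NormedSpace ℝ F]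
    (B : Euc n →L[ℝ] Euc n →L[ℝ] F) (v w : Euc n) :
    B v w = ∑ a, ∑ b, (v a * w b) • B (bv n a) (bv n b) := by
  rw [clm_apply_eq_sum B v, sum_apply]
  refine Finset.sum_congr rfl fun a _ => ?_
  rw [smul_apply, clm_apply_eq_sum (B (bv n a)) w, Finset.smul_sum]
  exact Finset.sum_congr rfl fun b _ => smul_smul _ _ _

theorem pdV_pdV_eq {n m : ℕ} {X : Euc n → Euc m} {p : Euc n} (hX : ContDiffAt ℝ 2 X p)
    (i j : Fin n) : pdV (pdV X j) i p = fderiv ℝ (fderiv ℝ X) p (bv n i) (bv n j) := by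
  have := dirD_dirD (s := fun _ => bv n i) (t := fun _ => bv n j) hX (differentiableAt_const _)
  rw [dirD_const, map_zero, add_zero] at this
  exact this

theorem pd_pd_eq {n : ℕ} {f : Euc n → ℝ} {p : Euc n} (hf : ContDiffAt ℝ 2 f p)
    (i j : Fin n) : pd (pd f j) i p = fderiv ℝ (fderiv ℝ f) p (bv n i) (bv n j) := by
  have := dirD_dirD (s := fun _ => bv n i) (t := fun _ => bv n j) hf (differentiableAt_const _)
  rw [dirD_const, map_zero, add_zero] at this
  exact this

theorem pd_gm {n : ℕ} {X : Euc n → Euc (n + 1)} {p : Euc n} (hX : ContDiffAt ℝ 2 X p)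
    (i j l : Fin n) : pd (gm X j l) i p
      = ⟪pdV (pdV X j) i p, pdV X l p⟫ + ⟪pdV X j p, pdV (pdV X l) i p⟫ := by
  have h1 : ∀ j, DifferentiableAt ℝ (pdV X j) p := fun j =>
    ((hX.fderiv_right (m := 1) (by norm_num)).differentiableAt (by simp)).clm_apply
      (differentiableAt_const _)
  exact dirD_inner (t := fun _ => bv n i) (h1 j) (h1 l)

theorem christ_eq {n : ℕ} {X : Euc n → Euc (n + 1)} {p : Euc n} (hX : ContDiffAt ℝ 2 X p)
    (k i j : Fin n) :
    christ X k i j p = ∑ l, gInv X p k l * ⟪pdV (pdV X j) i p, pdV X l p⟫ := by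
  have hsymm : ∀ i j, pdV (pdV X j) i p = pdV (pdV X i) j p := by
    intro i j
    rw [pdV_pdV_eq hX, pdV_pdV_eq hX, (hX.isSymmSndFDerivAt (by simp)).eq]
  unfold christ
  rw [Finset.mul_sum]
  refine Finset.sum_congr rfl fun l _ => ?_
  rw [pd_gm hX, pd_gm hX, pd_gm hX, hsymm l i, hsymm l j, hsymm j i,
    real_inner_comm (pdV (pdV X l) i p), real_inner_comm (pdV (pdV X l) j p)]
  ring

theorem sum_gInv_mul {n : ℕ} {X : Euc n → Euc (n + 1)} {t : Fin n → Euc n → Euc n} {p : Euc n}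
    (hinv : ∀ a b, gInv X p a b = ∑ m, t m p a * t m p b) (B : Fin n → Fin n → ℝ) :
    ∑ a, ∑ b, gInv X p a b * B a b = ∑ m, ∑ a, ∑ b, t m p a * t m p b * B a b := by
  rw [Finset.sum_comm (s := Finset.univ) (f := fun m a => ∑ b, t m p a * t m p b * B a b)]
  refine Finset.sum_congr rfl fun a _ => ?_
  rw [Finset.sum_comm]
  simp only [hinv, Finset.sum_mul]

theorem gradSq_eq_sum {n : ℕ} {X : Euc n → Euc (n + 1)} {t : Fin n → Euc n → Euc n} {p : Euc n}
    (hinv : ∀ a b, gInv X p a b = ∑ m, t m p a * t m p b) (f g : Euc n → ℝ) :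
    gradSq X f g p = ∑ m, dirD (t m) f p * dirD (t m) g p := by
  simp only [gradSq, mul_assoc]
  rw [sum_gInv_mul hinv]
  refine Finset.sum_congr rfl fun m _ => ?_
  rw [dirD, dirD, clm_apply_eq_sum, clm_apply_eq_sum (fderiv ℝ g p), Finset.sum_mul_sum]
  refine Finset.sum_congr rfl fun a _ => Finset.sum_congr rfl fun b _ => ?_
  simp only [smul_eq_mul, pd]
  ring

theorem driftTerm_eq_sum {n : ℕ} {X : Euc n → Euc (n + 1)} (ν : Euc n → Euc (n + 1))
    {t : Fin n → Euc n → Euc n} {p : Euc n}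
    (hinv : ∀ a b, gInv X p a b = ∑ m, t m p a * t m p b) (f : Euc n → ℝ) :
    driftTerm X ν f p = ∑ m, ⟪X p, dirD (t m) X p⟫ * dirD (t m) f p := by
  simp only [driftTerm, mul_assoc]
  rw [sum_gInv_mul hinv]
  refine Finset.sum_congr rfl fun m _ => ?_
  rw [dirD, dirD, clm_apply_eq_sum, clm_apply_eq_sum (fderiv ℝ f p), inner_sum,
    Finset.sum_mul_sum]
  refine Finset.sum_congr rfl fun a _ => Finset.sum_congr rfl fun b _ => ?_
  simp only [smul_eq_mul, pd, pdV, inner_smul_right, real_inner_comm (X p)]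
  ring

theorem sum_christ_mul_pd {n : ℕ} {X : Euc n → Euc (n + 1)} {t : Fin n → Euc n → Euc n}
    {p : Euc n} (hinv : ∀ a b, gInv X p a b = ∑ m, t m p a * t m p b)
    (hX : ContDiffAt ℝ 2 X p) (f : Euc n → ℝ) (i j : Fin n) :
    ∑ a, christ X a i j p * pd f a p
      = ∑ m, ⟪pdV (pdV X j) i p, dirD (t m) X p⟫ * dirD (t m) f p := by
  have h1 : ∑ a, christ X a i j p * pd f a p
      = ∑ a, ∑ b, gInv X p a b * (pd f a p * ⟪pdV (pdV X j) i p, pdV X b p⟫) := by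
    refine Finset.sum_congr rfl fun a _ => ?_
    rw [christ_eq hX, Finset.sum_mul]
    exact Finset.sum_congr rfl fun b _ => by ring
  rw [h1, sum_gInv_mul hinv]
  refine Finset.sum_congr rfl fun m _ => ?_
  rw [dirD, dirD, clm_apply_eq_sum, clm_apply_eq_sum (fderiv ℝ f p), inner_sum, mul_comm,
    Finset.sum_mul_sum]
  refine Finset.sum_congr rfl fun a _ => Finset.sum_congr rfl fun b _ => ?_
  simp only [smul_eq_mul, pd, pdV, inner_smul_right]
  ring

theorem lapBel_eq_sum {n : ℕ} {X : Euc n → Euc (n + 1)} {t : Fin n → Euc n → Euc n}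
    {p : Euc n} (hinv : ∀ a b, gInv X p a b = ∑ m, t m p a * t m p b)
    (hX : ContDiffAt ℝ 2 X p) {f : Euc n → ℝ} (hf : ContDiffAt ℝ 2 f p) :
    lapBel X f p = ∑ l, (fderiv ℝ (fderiv ℝ f) p (t l p) (t l p)
      - ∑ m, ⟪fderiv ℝ (fderiv ℝ X) p (t l p) (t l p), dirD (t m) X p⟫ * dirD (t m) f p) := by
  simp only [lapBel, sum_christ_mul_pd hinv hX]
  rw [sum_gInv_mul hinv]
  refine Finset.sum_congr rfl fun l _ => ?_
  rw [clm_apply₂_eq_sum (fderiv ℝ (fderiv ℝ f) p), clm_apply₂_eq_sum (fderiv ℝ (fderiv ℝ X) p)]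
  simp only [pd_pd_eq hf, pdV_pdV_eq hX, mul_sub, Finset.sum_sub_distrib, sum_inner,
    inner_smul_left, conj_trivial, smul_eq_mul, Finset.sum_mul, Finset.mul_sum]
  congr 1
  conv_rhs => rw [Finset.sum_comm]
  refine Finset.sum_congr rfl fun a _ => ?_
  conv_rhs => rw [Finset.sum_comm]
  simp only [mul_assoc]

theorem IsPrincipalFrame.lapBel_add_driftTerm {n : ℕ} {X ν : Euc n → Euc (n + 1)}
    {Ω : Set (Euc n)} {κ : Euc n → Fin n → ℝ} {t : Fin n → Euc n → Euc n} {p : Euc n}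
    (h : IsPrincipalFrame X ν Ω κ t) (hp : p ∈ Ω)
    (hinv : ∀ a b, gInv X p a b = ∑ m, t m p a * t m p b) {f : Euc n → ℝ}
    (hf : ContDiffAt ℝ 2 f p) :
    lapBel X f p + driftTerm X ν f p = frameDriftLap X t f p := by
  have hX := h.smooth_immersion.contDiffAt_two_of_isOpen h.isOpen hp
  have ht := fun i => (h.smooth_frame i).differentiableAt_of_isOpen h.isOpen hp
  rw [lapBel_eq_sum hinv hX hf, driftTerm_eq_sum ν hinv, ← Finset.sum_add_distrib]
  refine Finset.sum_congr rfl fun l _ => ?_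
  congr 1
  rw [dirD_dirD hf (ht l)]
  have h1 : fderiv ℝ f p (dirD (t l) (t l) p)
      = ∑ m, ⟪fderiv ℝ X p (dirD (t l) (t l) p), dirD (t m) X p⟫ * dirD (t m) f p := by
    conv_lhs => rw [h.expand p hp (dirD (t l) (t l) p)]
    simp [map_sum, dirD]
  simp only [conn, dirD_dirD hX (ht l), inner_add_left, add_mul, Finset.sum_add_distrib, h1]
  ring

/-- First derivative of the Spruck–Xiao cutoff. -/
def phiSXDeriv : ℝ → ℝ :=
  fun t => if t < 0 then -(4 * t ^ 3 + 2 * t) * Real.exp (-1 / t ^ 2) else 0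

/-- Second derivative of the Spruck–Xiao cutoff. -/
def phiSXDeriv₂ : ℝ → ℝ :=
  fun t => if t < 0 then -(12 * t ^ 2 + 10 + 4 / t ^ 2) * Real.exp (-1 / t ^ 2) else 0

theorem phiSXDeriv_nonneg (t : ℝ) : 0 ≤ phiSXDeriv t := by
  unfold phiSXDeriv
  split_ifs with h
  · have : 0 ≤ -(4 * t ^ 3 + 2 * t) := by nlinarith [sq_nonneg t]
    positivity
  · rfl

theorem phiSXDeriv₂_nonpos (t : ℝ) : phiSXDeriv₂ t ≤ 0 := by
  unfold phiSXDeriv₂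
  split_ifs with h
  · rw [neg_mul, neg_nonpos]
    positivity
  · rfl

theorem exp_neg_one_div_sq_le (t : ℝ) (ht : t ≠ 0) : Real.exp (-1 / t ^ 2) ≤ t ^ 2 := by
  have h1 := Real.add_one_le_exp (1 / t ^ 2)
  have h2 : 0 < 1 / t ^ 2 := by positivity
  rw [neg_div, Real.exp_neg, inv_le_comm₀ (Real.exp_pos _) (by positivity), ← one_div]
  linarith

theorem hasDerivAt_exp_neg_one_div_sq {t : ℝ} (ht : t ≠ 0) :
    HasDerivAt (fun t : ℝ => Real.exp (-1 / t ^ 2)) (Real.exp (-1 / t ^ 2) * (2 / t ^ 3)) t := by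
  have h1 : HasDerivAt (fun t : ℝ => -1 / t ^ 2) (2 / t ^ 3) t := by
    refine ((hasDerivAt_const t (-1 : ℝ)).div (hasDerivAt_pow 2 t) (by positivity)).congr_deriv ?_
    field_simp
    norm_num
    ring
  exact h1.exp

theorem hasDerivAt_zero_of_sq_bound {f : ℝ → ℝ} {C : ℝ} (h : ∀ t, |t| ≤ 1 → |f t| ≤ C * t ^ 2) :
    HasDerivAt f 0 0 := by
  have hO : f =O[nhds 0] fun t => ‖t - 0‖ ^ 2 := by
    refine Asymptotics.IsBigO.of_bound C ?_
    filter_upwards [Metric.closedBall_mem_nhds (0 : ℝ) one_pos] with t ht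
    simpa using h t (by simpa using ht)
  simpa using (hO.hasFDerivAt one_lt_two).hasDerivAt

theorem hasDerivAt_ite_neg {f f' : ℝ → ℝ} {C : ℝ} (hf : ∀ t < 0, HasDerivAt f (f' t) t)
    (hb : ∀ t < 0, |t| ≤ 1 → |f t| ≤ C * t ^ 2) (hC : 0 ≤ C) (t : ℝ) :
    HasDerivAt (fun t => if t < 0 then f t else 0) (if t < 0 then f' t else 0) t := by
  rcases lt_trichotomy t 0 with h | h | h
  · rw [if_pos h]
    refine (hf t h).congr_of_eventuallyEq ?_
    filter_upwards [Iio_mem_nhds h] with u hu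
    exact if_pos hu
  · subst h
    rw [if_neg (lt_irrefl _)]
    refine hasDerivAt_zero_of_sq_bound (C := C) fun u hu => ?_
    split_ifs with hneg
    · exact hb u hneg hu
    · rw [abs_zero]; positivity
  · rw [if_neg h.not_gt]
    refine (hasDerivAt_const t (0 : ℝ)).congr_of_eventuallyEq ?_
    filter_upwards [Ioi_mem_nhds h] with u hu
    exact if_neg (not_lt.2 (le_of_lt hu))

theorem hasDerivAt_phiSX (t : ℝ) : HasDerivAt phiSX (phiSXDeriv t) t := by
  refine hasDerivAt_ite_neg (f' := fun t => -(4 * t ^ 3 + 2 * t) * Real.exp (-1 / t ^ 2))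
    (C := 1) (fun t ht => ?_) (fun t ht h1 => ?_) zero_le_one t
  · refine ((hasDerivAt_pow 4 t).neg.mul (hasDerivAt_exp_neg_one_div_sq ht.ne)).congr_deriv ?_
    have := ht.ne
    simp only [Pi.neg_apply]
    field_simp
    push_cast
    ring
  · have h2 : Real.exp (-1 / t ^ 2) ≤ 1 := Real.exp_le_one_iff.2 (by
      rw [neg_div, neg_nonpos]; positivity)
    have h3 : t ^ 2 ≤ 1 := by nlinarith [abs_le.1 h1]
    rw [abs_mul, abs_neg, abs_of_nonneg (by positivity), abs_of_pos (Real.exp_pos _)]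
    nlinarith [sq_nonneg t, Real.exp_pos (-1 / t ^ 2), mul_nonneg (sq_nonneg t) (sq_nonneg t)]

theorem hasDerivAt_phiSXDeriv (t : ℝ) : HasDerivAt phiSXDeriv (phiSXDeriv₂ t) t := by
  refine hasDerivAt_ite_neg
    (f' := fun t => -(12 * t ^ 2 + 10 + 4 / t ^ 2) * Real.exp (-1 / t ^ 2))
    (C := 6) (fun t ht => ?_) (fun t ht h1 => ?_) (by norm_num) t
  · refine ((((hasDerivAt_pow 3 t).const_mul 4).add ((hasDerivAt_id t).const_mul 2)).neg.mul
      (hasDerivAt_exp_neg_one_div_sq ht.ne)).congr_deriv ?_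
    have := ht.ne
    simp only [Pi.neg_apply, Pi.add_apply, id]
    field_simp
    push_cast
    ring
  · have h2 := exp_neg_one_div_sq_le t ht.ne
    have h3 : t ^ 2 ≤ 1 := by nlinarith [abs_le.1 h1]
    have h4 : |-(4 * t ^ 3 + 2 * t)| ≤ 6 := by
      have := abs_le.1 h1
      rw [abs_le]
      constructor <;> nlinarith
    rw [abs_mul, abs_of_pos (Real.exp_pos _)]
    exact mul_le_mul h4 h2 (Real.exp_pos _).le (by norm_num)

section ChainRule

variable {n : ℕ} {φ φ' : ℝ → ℝ} {q : Euc n → ℝ} {p : Euc n}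

theorem pd_comp (hφ : ∀ t, HasDerivAt φ (φ' t) t) (hq : DifferentiableAt ℝ q p) (j : Fin n) :
    pd (fun x => φ (q x)) j p = φ' (q p) * pd q j p := by
  have := (hφ (q p)).comp_hasFDerivAt p hq.hasFDerivAt
  change fderiv ℝ (φ ∘ q) p (bv n j) = _
  rw [this.fderiv]
  simp [pd]

theorem pd_pd_comp {φ'' : ℝ → ℝ} (hφ : ∀ t, HasDerivAt φ (φ' t) t)
    (hφ' : ∀ t, HasDerivAt φ' (φ'' t) t) (hq : ContDiffAt ℝ 2 q p) (i j : Fin n) :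
    pd (pd (fun x => φ (q x)) j) i p
      = φ'' (q p) * pd q i p * pd q j p + φ' (q p) * pd (pd q j) i p := by
  have hev : pd (fun x => φ (q x)) j =ᶠ[nhds p] fun x => φ' (q x) * pd q j x := by
    filter_upwards [hq.eventually (by simp)] with x hx
    exact pd_comp hφ (hx.differentiableAt (by simp)) j
  have hq1 : DifferentiableAt ℝ q p := hq.differentiableAt (by simp)
  have hq2 : DifferentiableAt ℝ (pd q j) p :=
    ((hq.fderiv_right (m := 1) (by norm_num)).differentiableAt (by simp)).clm_apply
      (differentiableAt_const _)
  have hq3 : DifferentiableAt ℝ (fun x => φ' (q x)) p :=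
    (hφ' (q p)).differentiableAt.comp p hq1
  rw [pd, hev.fderiv_eq]
  change dirD (fun _ => bv n i) _ p = _
  rw [dirD_mul hq3 hq2, ← pd_comp hφ' hq1 i]
  rfl

theorem Lop_comp {φ'' : ℝ → ℝ} (X ν : Euc n → Euc (n + 1)) (hφ : ∀ t, HasDerivAt φ (φ' t) t)
    (hφ' : ∀ t, HasDerivAt φ' (φ'' t) t) (hq : ContDiffAt ℝ 2 q p) :
    Lop X ν (fun x => φ (q x)) p
      = φ' (q p) * Lop X ν q p + φ'' (q p) * gradSq X q q p := by
  have h1 := pd_comp hφ (hq.differentiableAt (by simp))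
  have hlap : lapBel X (fun x => φ (q x)) p
      = φ' (q p) * lapBel X q p + φ'' (q p) * gradSq X q q p := by
    simp only [lapBel, gradSq, Finset.mul_sum, ← Finset.sum_add_distrib]
    refine Finset.sum_congr rfl fun i _ => Finset.sum_congr rfl fun j _ => ?_
    simp only [pd_pd_comp hφ hφ' hq, h1, mul_left_comm _ (φ' (q p)), ← Finset.mul_sum]
    ring
  have hdrift : driftTerm X ν (fun x => φ (q x)) p = φ' (q p) * driftTerm X ν q p := by
    simp only [driftTerm, Finset.mul_sum, h1]
    exact Finset.sum_congr rfl fun i _ => Finset.sum_congr rfl fun j _ => by ring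
  have hgrad : gradSq X (fun x => φ (q x)) (meanCurv X ν) p
      = φ' (q p) * gradSq X q (meanCurv X ν) p := by
    simp only [gradSq, Finset.mul_sum, h1]
    exact Finset.sum_congr rfl fun i _ => Finset.sum_congr rfl fun j _ => by ring
  rw [Lop, Lop, hlap, hdrift, hgrad]
  ring

end ChainRule

/-- Pairs within `S` cancel by antisymmetry, the remaining ones are nonpositive. -/
theorem sum_sum_sub_mul_nonpos {ι : Type*} [Fintype ι] [DecidableEq ι] (S : Finset ι)
    (κ : ι → ℝ) (w : ι → ι → ℝ) (hw : ∀ s m, w s m = w m s) (hw0 : ∀ s m, 0 ≤ w s m)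
    (hS : ∀ s ∈ S, ∀ m ∉ S, κ s ≤ κ m) : ∑ s ∈ S, ∑ m, (κ s - κ m) * w s m ≤ 0 := by
  have hanti : ∑ s ∈ S, ∑ m ∈ S, (κ s - κ m) * w s m = 0 := by
    have hswap : ∑ s ∈ S, ∑ m ∈ S, (κ s - κ m) * w s m
        = -∑ s ∈ S, ∑ m ∈ S, (κ s - κ m) * w s m := by
      conv_lhs => rw [Finset.sum_comm]
      simp only [← Finset.sum_neg_distrib]
      refine Finset.sum_congr rfl fun s _ => Finset.sum_congr rfl fun m _ => ?_
      rw [hw m s]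
      ring
    linarith
  simp only [← Finset.sum_add_sum_compl S, Finset.sum_add_distrib] at hanti ⊢
  rw [hanti, zero_add]
  refine Finset.sum_nonpos fun s hs => Finset.sum_nonpos fun m hm => ?_
  exact mul_nonpos_of_nonpos_of_nonneg
    (sub_nonpos.2 (hS s hs m (Finset.mem_compl.1 hm))) (hw0 s m)

theorem sum_sum_sub_mul_eq_zero {ι : Type*} [Fintype ι] (κ : ι → ℝ) (w : ι → ι → ℝ)
    (hw : ∀ s m, w s m = w m s) : ∑ s, ∑ m, (κ s - κ m) * w s m = 0 := by
  have hswap : ∑ s, ∑ m, (κ s - κ m) * w s m = -∑ s, ∑ m, (κ s - κ m) * w s m := by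
    conv_lhs => rw [Finset.sum_comm]
    simp only [← Finset.sum_neg_distrib]
    refine Finset.sum_congr rfl fun s _ => Finset.sum_congr rfl fun m _ => ?_
    rw [hw m s]
    ring
  linarith

namespace IsPrincipalFrame

variable {n : ℕ} {X ν : Euc n → Euc (n + 1)} {Ω : Set (Euc n)} {κ : Euc n → Fin n → ℝ}
  {t : Fin n → Euc n → Euc n} {p : Euc n} {f g H : Euc n → ℝ}

theorem frameDriftLap_congr (h : IsPrincipalFrame X ν Ω κ t) (hp : p ∈ Ω)
    (hfg : Set.EqOn f g Ω) : frameDriftLap X t f p = frameDriftLap X t g p := by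
  have h1 : ∀ i, Set.EqOn (dirD (t i) f) (dirD (t i) g) Ω :=
    fun i q hq => dirD_congr h.isOpen hfg hq
  unfold frameDriftLap
  refine Finset.sum_congr rfl fun i _ => ?_
  rw [dirD_congr h.isOpen (h1 i) hp, h1 i hp]
  simp only [fun m => h1 m hp]

theorem frameDriftLap_sum (h : IsPrincipalFrame X ν Ω κ t) (hp : p ∈ Ω) {ι : Type*}
    (S : Finset ι) {f : ι → Euc n → ℝ} (hf : ∀ s, ContDiffOn ℝ (⊤ : ℕ∞) (f s) Ω) :
    frameDriftLap X t (fun q => ∑ s ∈ S, f s q) p = ∑ s ∈ S, frameDriftLap X t (f s) p := by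
  have h1 : ∀ i, Set.EqOn (dirD (t i) fun q => ∑ s ∈ S, f s q)
      (fun q => ∑ s ∈ S, dirD (t i) (f s) q) Ω := fun i q hq =>
    dirD_sum S fun s _ => (hf s).differentiableAt_of_isOpen h.isOpen hq
  unfold frameDriftLap
  rw [Finset.sum_comm]
  refine Finset.sum_congr rfl fun i _ => ?_
  rw [dirD_congr h.isOpen (h1 i) hp, h1 i hp, dirD_sum S fun s _ =>
    (h.smooth_dirD (hf s) i).differentiableAt_of_isOpen h.isOpen hp]
  simp only [fun m => h1 m hp, Finset.mul_sum, Finset.sum_add_distrib, Finset.sum_sub_distrib]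
  rw [Finset.sum_comm]

theorem frameDriftLap_mul (h : IsPrincipalFrame X ν Ω κ t) (hp : p ∈ Ω)
    (hf : ContDiffOn ℝ (⊤ : ℕ∞) f Ω) (hg : ContDiffOn ℝ (⊤ : ℕ∞) g Ω) :
    frameDriftLap X t (fun q => f q * g q) p
      = frameDriftLap X t f p * g p + f p * frameDriftLap X t g p
        + 2 * ∑ i, dirD (t i) f p * dirD (t i) g p := by
  have hd {f : Euc n → ℝ} (hf : ContDiffOn ℝ (⊤ : ℕ∞) f Ω) {q : Euc n} (hq : q ∈ Ω) :=
    hf.differentiableAt_of_isOpen h.isOpen hq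
  have h1 : ∀ i, Set.EqOn (dirD (t i) fun q => f q * g q)
      (fun q => dirD (t i) f q * g q + f q * dirD (t i) g q) Ω := fun i q hq =>
    dirD_mul (hd hf hq) (hd hg hq)
  have hdf := fun i => hd (h.smooth_dirD hf i) hp
  have hdg := fun i => hd (h.smooth_dirD hg i) hp
  unfold frameDriftLap
  rw [Finset.sum_mul, Finset.mul_sum, Finset.mul_sum, ← Finset.sum_add_distrib,
    ← Finset.sum_add_distrib]
  refine Finset.sum_congr rfl fun i _ => ?_
  have h2 : ∑ m, conn X t i i m p * dirD (t m) (fun q => f q * g q) p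
      = (∑ m, conn X t i i m p * dirD (t m) f p) * g p
        + f p * ∑ m, conn X t i i m p * dirD (t m) g p := by
    rw [Finset.sum_mul, Finset.mul_sum, ← Finset.sum_add_distrib]
    refine Finset.sum_congr rfl fun m _ => ?_
    rw [h1 m hp]
    ring
  rw [dirD_congr h.isOpen (h1 i) hp, dirD_add (f := fun q => dirD (t i) f q * g q)
      (g := fun q => f q * dirD (t i) g q) ((hdf i).mul (hd hg hp)) ((hd hf hp).mul (hdg i)),
    dirD_mul (hdf i) (hd hg hp), dirD_mul (hd hf hp) (hdg i), h2, h1 i hp]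
  ring

/-- The mean curvature of a self-expander satisfies the Jacobi-type equation. -/
theorem frameDriftLap_meanCurv (h : IsPrincipalFrame X ν Ω κ t) (hp : p ∈ Ω)
    (hH : ∀ q ∈ Ω, H q = ⟪X q, ν q⟫) (hHκ : ∀ q ∈ Ω, H q = ∑ i, κ q i) :
    frameDriftLap X t H p = -(∑ i, κ p i ^ 2 + 1) * H p := by
  rw [h.frameDriftLap_congr hp hHκ, h.frameDriftLap_sum hp _ h.smooth_curvature]
  simp only [h.frameDriftLap_curvature hp hH hHκ, Finset.sum_add_distrib, ← Finset.mul_sum,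
    ← hHκ p hp]
  rw [Finset.sum_comm, Finset.sum_eq_zero fun i _ => sum_sum_sub_mul_eq_zero (κ p)
    (fun s m => conn X t i s m p ^ 2) fun s m => by rw [h.conn_antisymm hp, neg_sq]]
  ring

theorem frameDriftLap_partial_sum_le (h : IsPrincipalFrame X ν Ω κ t) (hp : p ∈ Ω)
    (hH : ∀ q ∈ Ω, H q = ⟪X q, ν q⟫) (hHκ : ∀ q ∈ Ω, H q = ∑ i, κ q i) (S : Finset (Fin n))
    (hS : ∀ s ∈ S, ∀ m ∉ S, κ p s ≤ κ p m) :
    frameDriftLap X t (fun q => ∑ s ∈ S, κ q s) p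
      ≤ -(∑ i, κ p i ^ 2 + 1) * ∑ s ∈ S, κ p s := by
  rw [h.frameDriftLap_sum hp _ h.smooth_curvature]
  simp only [h.frameDriftLap_curvature hp hH hHκ, Finset.sum_add_distrib, ← Finset.mul_sum]
  rw [Finset.sum_comm]
  have := Finset.sum_nonpos fun i (_ : i ∈ Finset.univ) => sum_sum_sub_mul_nonpos S (κ p)
    (fun s m => conn X t i s m p ^ 2) (fun s m => by rw [h.conn_antisymm hp, neg_sq])
    (fun s m => sq_nonneg _) hS
  linarith

end IsPrincipalFrame

theorem isPrincipalFrame_of_components {n : ℕ} {X ν : Euc n → Euc (n + 1)} {Ω : Set (Euc n)}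
    (hΩ : IsOpen Ω) (hX : ContDiffOn ℝ (⊤ : ℕ∞) X Ω) (hν : ContDiffOn ℝ (⊤ : ℕ∞) ν Ω)
    (hunit : ∀ p ∈ Ω, ‖ν p‖ = 1) (horth : ∀ p ∈ Ω, ∀ i, ⟪ν p, pdV X i p⟫ = (0 : ℝ))
    {κ : Euc n → Fin n → ℝ} (hκ : ∀ i, ContDiffOn ℝ (⊤ : ℕ∞) (fun p => κ p i) Ω)
    {τ : Euc n → Fin n → Fin n → ℝ}
    (hτ : ∀ i a, ContDiffOn ℝ (⊤ : ℕ∞) (fun p => τ p i a) Ω)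
    (hτorth : ∀ p ∈ Ω, ∀ i j,
      (∑ a, ∑ b, gm X a b p * τ p i a * τ p j b) = if i = j then (1 : ℝ) else 0)
    (hτeig : ∀ p ∈ Ω, ∀ (i b : Fin n),
      (∑ a, sff X ν a b p * τ p i a) = κ p i * ∑ a, gm X a b p * τ p i a) :
    IsPrincipalFrame X ν Ω κ (fun i p => WithLp.toLp 2 (τ p i))
      ∧ (∀ p ∈ Ω, ∀ a b, gInv X p a b = ∑ m, τ p m a * τ p m b)
      ∧ ∀ p ∈ Ω, meanCurv X ν p = ∑ i, κ p i := by
  have hpair : ∀ p i j, ⟪dirD (fun p => WithLp.toLp 2 (τ p i)) X p,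
      dirD (fun p => WithLp.toLp 2 (τ p j)) X p⟫ = ∑ a, ∑ b, gm X a b p * τ p i a * τ p j b := by
    intro p i j
    rw [dirD, dirD, clm_apply_eq_sum, clm_apply_eq_sum _ (WithLp.toLp 2 (τ p j)), sum_inner]
    refine Finset.sum_congr rfl fun a _ => ?_
    rw [inner_sum]
    refine Finset.sum_congr rfl fun b _ => ?_
    rw [inner_smul_left, inner_smul_right]
    simp only [gm, pdV, conj_trivial]
    ring
  have hright : ∀ p ∈ Ω, gMat X p * ((Matrix.of (τ p)).transpose * Matrix.of (τ p)) = 1 := by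
    intro p hp
    have h1 : Matrix.of (τ p) * (gMat X p * (Matrix.of (τ p)).transpose) = 1 := by
      ext i j
      rw [Matrix.one_apply, ← hτorth p hp i j]
      simp only [Matrix.mul_apply, gMat, Matrix.of_apply, Matrix.transpose_apply, Finset.mul_sum]
      exact Finset.sum_congr rfl fun a _ => Finset.sum_congr rfl fun b _ => by ring
    rw [← Matrix.mul_assoc]
    exact mul_eq_one_comm.1 h1
  have hinv : ∀ p ∈ Ω, ∀ a b, gInv X p a b = ∑ m, τ p m a * τ p m b := by
    intro p hp a b
    rw [gInv, Matrix.inv_eq_right_inv (hright p hp)]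
    simp [Matrix.mul_apply]
  have hsff : ∀ p ∈ Ω, ∀ i j, ∑ a, ∑ b, τ p i a * τ p j b * sff X ν b a p
      = if i = j then κ p i else 0 := by
    intro p hp i j
    have h1 : ∑ a, ∑ b, τ p i a * τ p j b * sff X ν b a p
        = κ p j * ∑ b, ∑ a, gm X b a p * τ p j b * τ p i a := by
      rw [Finset.sum_comm (s := Finset.univ) (f := fun b a => gm X b a p * τ p j b * τ p i a),
        Finset.mul_sum]
      refine Finset.sum_congr rfl fun a _ => ?_
      rw [← Finset.sum_mul, ← mul_assoc, ← hτeig p hp j a, Finset.sum_mul]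
      exact Finset.sum_congr rfl fun b _ => by ring
    rw [h1, hτorth p hp j i]
    by_cases e : i = j
    · subst e; simp
    · simp [e, Ne.symm e]
  have ht : ∀ i, ContDiffOn ℝ (⊤ : ℕ∞) (fun p => (WithLp.toLp 2 (τ p i) : Euc n)) Ω :=
    fun i => contDiffOn_euclidean.2 fun a => hτ i a
  have hperp : ∀ p ∈ Ω, ∀ v, ⟪fderiv ℝ X p v, ν p⟫ = (0 : ℝ) := by
    intro p hp v
    rw [clm_apply_eq_sum, sum_inner]
    refine Finset.sum_eq_zero fun a _ => ?_
    have := horth p hp a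
    rw [real_inner_comm] at this
    rw [inner_smul_left]
    simpa [pdV] using Or.inr this
  refine ⟨⟨hΩ, hX, hν, ht, hκ, fun p hp i j => (hpair p i j).trans (hτorth p hp i j),
    fun p hp => ?_, hperp, fun p hp i j => ?_, fun p hp v => ?_⟩, hinv,
    fun p hp => ?_⟩
  · rw [real_inner_self_eq_norm_sq, hunit p hp, one_pow]
  · have hX2 := hX.contDiffAt_two_of_isOpen hΩ hp
    rw [dirD_dirD hX2 ((ht j).differentiableAt_of_isOpen hΩ hp), inner_add_left,
      hperp p hp, add_zero, ← hsff p hp i j, clm_apply₂_eq_sum, sum_inner]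
    refine Finset.sum_congr rfl fun a _ => ?_
    rw [sum_inner]
    refine Finset.sum_congr rfl fun b _ => ?_
    rw [inner_smul_left, sff, pdV_pdV_eq hX2]
    simp
  · ext c
    have h1 : ∀ m, ⟪fderiv ℝ X p v, dirD (fun p => WithLp.toLp 2 (τ p m)) X p⟫
        = ∑ a, v a * ∑ b, gm X a b p * τ p m b := by
      intro m
      rw [dirD, clm_apply_eq_sum, clm_apply_eq_sum _ (WithLp.toLp 2 (τ p m)), sum_inner]
      refine Finset.sum_congr rfl fun a _ => ?_
      rw [inner_sum, Finset.mul_sum]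
      refine Finset.sum_congr rfl fun b _ => ?_
      rw [inner_smul_left, inner_smul_right]
      simp only [gm, pdV, conj_trivial]
      ring
    have h2 := congrFun (congrArg (Matrix.vecMul v.ofLp) (hright p hp)) c
    rw [Matrix.vecMul_one] at h2
    rw [← h2]
    simp only [h1, Matrix.vecMul, dotProduct, Matrix.mul_apply, Matrix.transpose_apply,
      Matrix.of_apply, gMat, WithLp.ofLp_sum, Finset.sum_apply, WithLp.ofLp_smul, Pi.smul_apply,
      smul_eq_mul, Finset.mul_sum, Finset.sum_mul]
    conv_rhs => rw [Finset.sum_comm]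
    refine Finset.sum_congr rfl fun a _ => ?_
    conv_rhs => rw [Finset.sum_comm]
    exact Finset.sum_congr rfl fun b _ => Finset.sum_congr rfl fun m _ => by ring
  · have h1 : ∀ i, ∑ a, ∑ b, τ p i a * τ p i b * sff X ν a b p = κ p i := by
      intro i
      have := hsff p hp i i
      rw [if_pos rfl, Finset.sum_comm] at this
      rw [← this]
      exact Finset.sum_congr rfl fun a _ => Finset.sum_congr rfl fun b _ => by ring
    rw [meanCurv, sum_gInv_mul (t := fun i p => WithLp.toLp 2 (τ p i)) (hinv p hp)]
    exact Finset.sum_congr rfl fun i _ => h1 i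

/-- Lemma 3.4 of the paper.
On each connected component of Σ_A of a complete immersed two-sided mean convex
self-expander, for 1 ≤ k < n and φ = φ(λ_k/H) with the Spruck–Xiao cutoff,
Lφ = Δφ + ⟨∇φ, x⟩ + 2⟨∇φ, ∇H/H⟩ ≤ 0. -/
theorem stmt_12 {n k : ℕ} (hk1 : 1 ≤ k) (hkn : k < n)
    (X ν : Euc n → Euc (n + 1)) (Ω : Set (Euc n)) (hΩ : IsOpen Ω) (hconn : IsConnected Ω)
    (hX : ContDiff ℝ (⊤ : ℕ∞) X) (hν : ContDiff ℝ (⊤ : ℕ∞) ν)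
    (himm : ∀ p ∈ Ω, IsUnit (gMat X p).det)
    (hunit : ∀ p ∈ Ω, ‖ν p‖ = 1)
    (horth : ∀ p ∈ Ω, ∀ i, ⟪ν p, pdV X i p⟫ = (0 : ℝ))
    (hexp : ∀ p ∈ Ω, meanCurv X ν p = ⟪X p, ν p⟫)
    (hmc : ∀ p ∈ Ω, 0 < meanCurv X ν p)
    (κ : Euc n → Fin n → ℝ) (hκmono : ∀ p, Monotone (κ p))
    (hκeig : ∀ p ∈ Ω,
      (gInv X p * Matrix.of (fun i j => sff X ν i j p)).charpoly
        = ∏ i, (Polynomial.X - Polynomial.C (κ p i)))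
    (hκsmooth : ∀ i, ContDiffOn ℝ (⊤ : ℕ∞) (fun p => κ p i) Ω)
    (hSigA : ∀ p ∈ Ω, ∀ᶠ q in nhds p, numDistinct κ q = numDistinct κ p)
    (τ : Euc n → Fin n → Fin n → ℝ)
    (hτsmooth : ∀ i a, ContDiffOn ℝ (⊤ : ℕ∞) (fun p => τ p i a) Ω)
    (hτorth : ∀ p ∈ Ω, ∀ i j,
      (∑ a, ∑ b, gm X a b p * τ p i a * τ p j b) = if i = j then (1 : ℝ) else 0)
    (hτeig : ∀ p ∈ Ω, ∀ (i b : Fin n),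
      (∑ a, sff X ν a b p * τ p i a) = κ p i * ∑ a, gm X a b p * τ p i a) :
    ∀ p ∈ Ω, Lop X ν (fun q => phiSX (ratk X ν κ k q)) p ≤ 0 := by
  obtain ⟨h, hinv, hHκ⟩ := isPrincipalFrame_of_components hΩ hX.contDiffOn hν.contDiffOn hunit
    horth hκsmooth hτsmooth hτorth hτeig
  have hHs : ContDiffOn ℝ (⊤ : ℕ∞) (meanCurv X ν) Ω :=
    (ContDiffOn.sum fun i _ => hκsmooth i).congr hHκ
  have hqs : ContDiffOn ℝ (⊤ : ℕ∞) (ratk X ν κ k) Ω :=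
    (ContDiffOn.sum fun i _ => hκsmooth i).div hHs fun p hp => (hmc p hp).ne'
  intro p hp
  have hq2 := hqs.contDiffAt_two_of_isOpen hΩ hp
  rw [Lop_comp X ν hasDerivAt_phiSX hasDerivAt_phiSXDeriv hq2]
  have hgrad : 0 ≤ gradSq X (ratk X ν κ k) (ratk X ν κ k) p := by
    rw [gradSq_eq_sum (t := fun i p => WithLp.toLp 2 (τ p i)) (hinv p hp)]
    exact Finset.sum_nonneg fun m _ => mul_self_nonneg _
  have hle := h.frameDriftLap_partial_sum_le hp hexp hHκ
    (Finset.univ.filter fun i : Fin n => i.val < k) fun s hs m hm => hκmono p (by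
      simp only [Finset.mem_filter, Finset.mem_univ, true_and] at hs hm
      exact Fin.le_def.2 (by omega))
  have hmul : ∀ q ∈ Ω, lamk κ k q = ratk X ν κ k q * meanCurv X ν q := fun q hq =>
    (div_mul_cancel₀ _ (hmc q hq).ne').symm
  have hLop : Lop X ν (ratk X ν κ k) p ≤ 0 := by
    have hle' : frameDriftLap X _ (lamk κ k) p ≤ -(∑ i, κ p i ^ 2 + 1) * lamk κ k p := hle
    rw [h.frameDriftLap_congr hp hmul, h.frameDriftLap_mul hp hqs hHs,
      h.frameDriftLap_meanCurv hp hexp hHκ, hmul p hp] at hle'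
    refine nonpos_of_mul_nonpos_left ?_ (hmc p hp)
    rw [Lop, h.lapBel_add_driftTerm hp (hinv p hp) hq2,
      gradSq_eq_sum (t := fun i p => WithLp.toLp 2 (τ p i)) (hinv p hp), add_mul,
      div_mul_cancel₀ _ (hmc p hp).ne']
    linarith
  exact add_nonpos (mul_nonpos_of_nonneg_of_nonpos (phiSXDeriv_nonneg _) hLop)
    (mul_nonpos_of_nonpos_of_nonneg (phiSXDeriv₂_nonpos _) hgrad)

end
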